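/- arXiv:2108.03261 — 4 statements merged into one kernel-verified Lean document; each statement's English description precedes it below -/
import Mathlib

section
/- Let F be a finite field with q elements. If C and C₀ are cyclic subgroups of GL₂(F) each of order q² − 1, then C and C₀ are conjugate in GL₂(F). -/
open Matrix

/-- The algebra generated by a `2 × 2` matrix is spanned by `1` and that matrix. -/
lemma exists_eq_smul_add_algebraMap_of_mem_adjoin {R : Type*} [CommRing R] [Nontrivial R]
    {M N : Matrix (Fin 2) (Fin 2) R} (hN : N ∈ Algebra.adjoin R {M}) :
    ∃ a b : R, a • M + algebraMap R _ b = N := by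
  rw [Algebra.adjoin_singleton_eq_range_aeval] at hN
  obtain ⟨p, rfl⟩ := hN
  have hdeg : (p %ₘ M.charpoly).natDegree ≤ 1 := by
    have h2 : M.charpoly.natDegree = 2 := by simp [M.charpoly_natDegree_eq_dim]
    have h1 : M.charpoly ≠ 1 := fun h => by simp [h] at h2
    have := Polynomial.natDegree_modByMonic_lt p M.charpoly_monic h1
    lia
  obtain ⟨a, b, hab⟩ := Polynomial.exists_eq_X_add_C_of_natDegree_le_one hdeg
  refine ⟨a, b, ?_⟩
  have := Polynomial.aeval_modByMonic_eq_self_of_root (p := p) M.aeval_self_charpoly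
  rw [hab] at this
  simpa [Algebra.smul_def] using this

/-- A cyclic subgroup of `GL₂(F)` of order `|F|² - 1`, together with `0`, is a subalgebra. -/
lemma exists_subalgebra_mem_iff_eq_zero_or_mem {F : Type*} [Field F] [Fintype F]
    (C : Subgroup (GL (Fin 2) F)) (hC : IsCyclic C)
    (hcard : Nat.card C = Fintype.card F ^ 2 - 1) :
    ∃ A : Subalgebra F (Matrix (Fin 2) (Fin 2) F), Module.finrank F A = 2 ∧
      ∀ M, M ∈ A ↔ M = 0 ∨ ∃ c ∈ C, (c : Matrix (Fin 2) (Fin 2) F) = M := by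
  obtain ⟨g, hg⟩ := hC.exists_generator
  set A := Algebra.adjoin F {((g : GL (Fin 2) F) : Matrix (Fin 2) (Fin 2) F)} with hA
  let S : Set (Matrix (Fin 2) (Fin 2) F) :=
    insert 0 ((fun c : GL (Fin 2) F => (c : Matrix (Fin 2) (Fin 2) F)) '' C)
  have hpow : ∀ n : ℕ, ((g : GL (Fin 2) F) : Matrix (Fin 2) (Fin 2) F) ^ n ∈ A := fun n =>
    A.pow_mem (Algebra.self_mem_adjoin_singleton F _) n
  have hSA : S ⊆ A := by
    rintro M (rfl | ⟨c, hc, rfl⟩)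
    · exact A.zero_mem
    · obtain ⟨n, hn⟩ := (mem_powers_iff_mem_zpowers (x := g)).2 (hg ⟨c, hc⟩)
      have : (g : GL (Fin 2) F) ^ n = c := congrArg Subtype.val hn
      simpa [← this] using hpow n
  have hcardS : S.ncard = Fintype.card F ^ 2 := by
    have h0 : (0 : Matrix (Fin 2) (Fin 2) F) ∉
        (fun c : GL (Fin 2) F => (c : Matrix (Fin 2) (Fin 2) F)) '' C := by
      rintro ⟨c, -, hc⟩
      exact c.ne_zero hc
    have hpos : 0 < Fintype.card F ^ 2 := pow_pos Fintype.card_pos 2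
    rw [Set.ncard_insert_of_notMem h0, Set.ncard_image_of_injective _ Units.val_injective,
      ← Nat.card_coe_set_eq]
    change Nat.card C + 1 = _
    lia
  have hcardA : (A : Set (Matrix (Fin 2) (Fin 2) F)).ncard ≤ Fintype.card F ^ 2 := by
    have hsub : (A : Set (Matrix (Fin 2) (Fin 2) F)) ⊆ Set.range fun x : F × F =>
        x.1 • ((g : GL (Fin 2) F) : Matrix (Fin 2) (Fin 2) F) + algebraMap F _ x.2 := fun N hN => by
      obtain ⟨a, b, h⟩ := exists_eq_smul_add_algebraMap_of_mem_adjoin hN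
      exact ⟨(a, b), h⟩
    refine (Set.ncard_le_ncard hsub).trans ?_
    rw [← Set.image_univ]
    refine (Set.ncard_image_le).trans ?_
    simp [Set.ncard_univ, sq]
  have hS : S = A := Set.eq_of_subset_of_ncard_le hSA (hcardA.trans hcardS.ge)
  have hdim : Module.finrank F A = 2 := by
    have h : Nat.card A = Fintype.card F ^ 2 := by
      rw [← hcardS, hS]
      exact Nat.card_coe_set_eq _
    rw [Module.natCard_eq_pow_finrank (K := F), Nat.card_eq_fintype_card] at h
    exact Nat.pow_right_injective Fintype.one_lt_card h
  exact ⟨A, hdim, fun M => by rw [← SetLike.mem_coe, ← hS]; simp [S]⟩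

/-- If the nonzero elements of a `2 × 2` matrix algebra of cardinality `|F|²` are invertible,
evaluation at a nonzero vector identifies the algebra with the plane. -/
lemma exists_linearEquiv_mulVec {F : Type*} [Field F]
    (A : Subalgebra F (Matrix (Fin 2) (Fin 2) F))
    (hunit : ∀ M ∈ A, M ≠ 0 → IsUnit M) (hdim : Module.finrank F A = 2) :
    ∃ e : A ≃ₗ[F] (Fin 2 → F), ∀ a b : A, e (a * b) = (a : Matrix (Fin 2) (Fin 2) F) *ᵥ e b := by
  let ev : A →ₗ[F] (Fin 2 → F) :=
    { toFun := fun a => (a : Matrix (Fin 2) (Fin 2) F) *ᵥ ![1, 0]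
      map_add' := fun a b => by simp [add_mulVec]
      map_smul' := fun r a => by simp [smul_mulVec] }
  have hinj : Function.Injective ev := by
    refine (injective_iff_map_eq_zero ev).2 fun a ha => ?_
    by_contra hne
    have hu := hunit a a.2 (by simpa using hne)
    have := mulVec_injective_of_isUnit hu (ha.trans (mulVec_zero _).symm)
    simpa using congrFun this 0
  refine ⟨LinearEquiv.ofInjectiveOfFinrankEq ev hinj (by simp [hdim]), fun a b => ?_⟩
  exact (mulVec_mulVec ![1, 0] (a : Matrix (Fin 2) (Fin 2) F) b).symm

/-- A matrix algebra over a finite field in which nonzero elements are invertible is a field. -/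
lemma isField_of_isUnit {F : Type*} [Field F] [Finite F]
    (A : Subalgebra F (Matrix (Fin 2) (Fin 2) F))
    (hunit : ∀ M ∈ A, M ≠ 0 → IsUnit M) : IsField A := by
  have : NoZeroDivisors A := ⟨fun {a b} hab => by
    by_contra! h
    have ha := hunit a a.2 (by simpa using h.1)
    have : (a : Matrix (Fin 2) (Fin 2) F) * b = 0 := congrArg Subtype.val hab
    exact h.2 (Subtype.ext (ha.mul_right_eq_zero.1 this))⟩
  have : IsDomain A := NoZeroDivisors.to_isDomain A
  exact Finite.isDomain_to_isField A

/-- Skolem–Noether for quadratic field extensions inside `2 × 2` matrices over a finite field. -/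
lemma exists_conj_mem {F : Type*} [Field F] [Finite F]
    (A B : Subalgebra F (Matrix (Fin 2) (Fin 2) F))
    (hA : ∀ M ∈ A, M ≠ 0 → IsUnit M) (hB : ∀ M ∈ B, M ≠ 0 → IsUnit M)
    (hdimA : Module.finrank F A = 2) (hdimB : Module.finrank F B = 2) :
    ∃ g : GL (Fin 2) F, ∀ M ∈ A, (g : Matrix (Fin 2) (Fin 2) F) * M * (g⁻¹ : GL (Fin 2) F) ∈ B := by
  obtain ⟨φ⟩ : Nonempty (A →ₐ[F] B) := by
    let := (isField_of_isUnit A hA).toField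
    let := (isField_of_isUnit B hB).toField
    exact FiniteField.nonempty_algHom_of_finrank_dvd (by rw [hdimA, hdimB])
  have hφ : Function.Injective φ := by
    let := (isField_of_isUnit A hA).toField
    exact φ.toRingHom.injective
  obtain ⟨eA, heA⟩ := exists_linearEquiv_mulVec A hA hdimA
  obtain ⟨eB, heB⟩ := exists_linearEquiv_mulVec B hB hdimB
  let T : (Fin 2 → F) ≃ₗ[F] (Fin 2 → F) :=
    eA.symm ≪≫ₗ LinearEquiv.ofInjectiveOfFinrankEq φ.toLinearMap hφ (hdimA.trans hdimB.symm) ≪≫ₗ eB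
  let g : GL (Fin 2) F := GeneralLinearGroup.toLin.symm (LinearMap.GeneralLinearGroup.ofLinearEquiv T)
  have hg : ∀ v, (g : Matrix (Fin 2) (Fin 2) F) *ᵥ v = T v := fun v => by
    rw [← mulVecLin_apply, ← GeneralLinearGroup.toLin_apply, MulEquiv.apply_symm_apply]
    rfl
  refine ⟨g, fun M hM => ?_⟩
  have key : (g : Matrix (Fin 2) (Fin 2) F) * M = (φ ⟨M, hM⟩ : Matrix (Fin 2) (Fin 2) F) * g := by
    refine Matrix.ext_of_mulVec_single fun i => ?_
    rw [← mulVec_mulVec, ← mulVec_mulVec, hg, hg]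
    obtain ⟨b, hb⟩ := eA.surjective (Pi.single i 1)
    have := heA ⟨M, hM⟩ b
    have hT : ∀ a : A, T (eA a) = eB (φ a) := fun a =>
      congrArg (fun a => eB (φ a)) (eA.symm_apply_apply a)
    rw [← hb, ← this, hT, hT, map_mul, heB]
  rw [key, mul_assoc, Units.mul_inv, mul_one]
  exact (φ ⟨M, hM⟩).2

/-- If `C` and `C₀` are cyclic subgroups of `GL₂(F)` of order `q² - 1`, where `q = |F|`,
then `C` and `C₀` are conjugate in `GL₂(F)`. -/
theorem stmt_10 (F : Type*) [Field F] [Fintype F] (C C₀ : Subgroup (GL (Fin 2) F))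
    (hC : IsCyclic C) (hC₀ : IsCyclic C₀)
    (hcard : Nat.card C = Fintype.card F ^ 2 - 1)
    (hcard₀ : Nat.card C₀ = Fintype.card F ^ 2 - 1) :
    ∃ g : GL (Fin 2) F, Subgroup.map (MulAut.conj g).toMonoidHom C = C₀ := by
  obtain ⟨A, hdimA, hA⟩ := exists_subalgebra_mem_iff_eq_zero_or_mem C hC hcard
  obtain ⟨B, hdimB, hB⟩ := exists_subalgebra_mem_iff_eq_zero_or_mem C₀ hC₀ hcard₀
  have hunit : ∀ {D : Subgroup (GL (Fin 2) F)} {M : Matrix (Fin 2) (Fin 2) F},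
      (M = 0 ∨ ∃ c ∈ D, (c : Matrix (Fin 2) (Fin 2) F) = M) → M ≠ 0 → IsUnit M := by
    rintro D M (h | ⟨c, -, rfl⟩) hM
    · exact absurd h hM
    · exact c.isUnit
  obtain ⟨g, hg⟩ := exists_conj_mem A B (fun M hM => hunit ((hA M).1 hM))
    (fun M hM => hunit ((hB M).1 hM)) hdimA hdimB
  refine ⟨g, Subgroup.eq_of_le_of_card_ge ?_ ?_⟩
  · rintro _ ⟨c, hc, rfl⟩
    rcases (hB _).1 (hg c ((hA _).2 (Or.inr ⟨c, hc, rfl⟩))) with h | ⟨d, hd, h⟩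
    · exact absurd h (g * c * g⁻¹).ne_zero
    · have : d = g * c * g⁻¹ := Units.ext h
      exact (this ▸ hd : g * c * g⁻¹ ∈ C₀)
  · rw [Subgroup.card_map_of_injective (MulAut.conj g).injective, hcard, hcard₀]
end

section
/- Let F be a finite field with q elements and let E be a field extension of F. For every nonzero vector w ∈ E² there exists a matrix g ∈ GL₂(F) (regarded inside GL₂(E)) such that g·w is not an E-scalar multiple of w. Equivalently, no point of the projective line P¹(E) is fixed by all of GL₂(F) acting by Möbius transformations, i.e. the stabilizer in GL₂(F) of any point of P¹(E) is a proper subgroup of GL₂(F). -/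
open Matrix

/-- For a finite field `F` and a field extension `E/F`, no nonzero vector `w ∈ E²` has all of
`GL₂(F)` mapping it to an `E`-scalar multiple of itself: the stabilizer in `GL₂(F)` of any
point of `P¹(E)` is proper. -/
theorem stmt_11 (F E : Type*) [Field F] [Fintype F] [Field E] [Algebra F E]
    (w : Fin 2 → E) (hw : w ≠ 0) :
    ∃ g : GL (Fin 2) F, ∀ c : E,
      ((Matrix.GeneralLinearGroup.map (n := Fin 2) (algebraMap F E) g :
        GL (Fin 2) E) : Matrix (Fin 2) (Fin 2) E).mulVec w ≠ c • w := by
  by_cases h : w 1 = 0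
  · have h0 : w 0 ≠ 0 := fun h0 => hw (by ext i; fin_cases i <;> assumption)
    refine ⟨Matrix.GeneralLinearGroup.mkOfDetNeZero !![1, 0; 1, 1] (by simp), fun c hc => h0 ?_⟩
    have h1 := congrFun hc 1
    simpa [Matrix.mulVec, dotProduct, Fin.sum_univ_two,
      Matrix.GeneralLinearGroup.mkOfDetNeZero, h] using h1
  · refine ⟨Matrix.GeneralLinearGroup.mkOfDetNeZero !![1, 1; 0, 1] (by simp), fun c hc => h ?_⟩
    have h0 := congrFun hc 0
    have h1 := congrFun hc 1
    simp [Matrix.mulVec, dotProduct, Fin.sum_univ_two,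
      Matrix.GeneralLinearGroup.mkOfDetNeZero] at h0 h1
    grind
end

section
/- Let B be a Dedekind domain that is an A-algebra whose structure map A → B is injective. Let a, b, c, d ∈ A with Δ = ad − bc ≠ 0, and suppose the ideal 𝔮 = aA + bA + cA + dA of A satisfies 𝔮² = ΔA. Then for all u, v ∈ B not both zero, the B-ideal generated by au + bv and cu + dv equals (𝔮B)·(uB + vB), where 𝔮B denotes the extension of 𝔮 to B. -/
/-- In a Dedekind domain, if the square of the ideal generated by the entries of a `2 × 2` matrix
with nonzero determinant is generated by that determinant, then applying the matrix to `(u, v)`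
multiplies the ideal `(u, v)` by the ideal of the entries. -/
theorem Ideal.span_pair_eq_mul_span_pair_of_sq_eq_span_det {B : Type*} [CommRing B]
    [IsDedekindDomain B] {a b c d : B} (hdet : a * d - b * c ≠ 0)
    (hq : Ideal.span {a, b, c, d} ^ 2 = Ideal.span {a * d - b * c}) (u v : B) :
    Ideal.span {a * u + b * v, c * u + d * v} =
      Ideal.span {a, b, c, d} * Ideal.span {u, v} := by
  have ha : a ∈ Ideal.span {a, b, c, d} := Ideal.subset_span (by simp)
  have hb : b ∈ Ideal.span {a, b, c, d} := Ideal.subset_span (by simp)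
  have hc : c ∈ Ideal.span {a, b, c, d} := Ideal.subset_span (by simp)
  have hd : d ∈ Ideal.span {a, b, c, d} := Ideal.subset_span (by simp)
  have hu : u ∈ Ideal.span {u, v} := Ideal.subset_span (by simp)
  have hv : v ∈ Ideal.span {u, v} := Ideal.subset_span (by simp)
  have hx : a * u + b * v ∈ Ideal.span {a * u + b * v, c * u + d * v} :=
    Ideal.subset_span (by simp)
  have hy : c * u + d * v ∈ Ideal.span {a * u + b * v, c * u + d * v} :=
    Ideal.subset_span (by simp)
  generalize Ideal.span {a, b, c, d} = Q at *
  have hQ0 : Q ≠ 0 := by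
    rintro rfl
    rw [zero_pow two_ne_zero, eq_comm, Ideal.zero_eq_bot, Ideal.span_singleton_eq_bot] at hq
    exact hdet hq
  apply le_antisymm
  · rw [Ideal.span_le, Set.pair_subset_iff]
    exact ⟨add_mem (Ideal.mul_mem_mul ha hu) (Ideal.mul_mem_mul hb hv),
      add_mem (Ideal.mul_mem_mul hc hu) (Ideal.mul_mem_mul hd hv)⟩
  · rw [← Ideal.dvd_iff_le, ← mul_dvd_mul_iff_left hQ0, Ideal.dvd_iff_le, ← mul_assoc, ← sq, hq,
      Ideal.span_singleton_mul_le_iff]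
    suffices h : Ideal.span {u, v} ≤
        Submodule.comap
          (LinearMap.mulLeft B (a * d - b * c))
          (Q * Ideal.span {a * u + b * v, c * u + d * v}) from fun z hz => h hz
    rw [Ideal.span_le, Set.pair_subset_iff]
    constructor
    · change (a * d - b * c) * u ∈ Q * Ideal.span {a * u + b * v, c * u + d * v}
      convert sub_mem (Ideal.mul_mem_mul hd hx) (Ideal.mul_mem_mul hb hy) using 1
      ring
    · change (a * d - b * c) * v ∈ Q * Ideal.span {a * u + b * v, c * u + d * v}
      convert sub_mem (Ideal.mul_mem_mul ha hy) (Ideal.mul_mem_mul hc hx) using 1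
      ring

/-- Let `B` be a Dedekind domain which is an `A`-algebra with injective structure map, and let
`a, b, c, d ∈ A` with `Δ = ad - bc ≠ 0` and `(a,b,c,d)² = (Δ)`. Then for `u, v ∈ B` not both
zero, the `B`-ideal `(au + bv, cu + dv)` equals `(𝔮B)·(u,v)`. -/
theorem stmt_12 (A B : Type*) [CommRing A] [IsDedekindDomain A] (hA : ¬ IsField A)
    [CommRing B] [IsDedekindDomain B] [Algebra A B]
    (hinj : Function.Injective (algebraMap A B))
    (a b c d : A) (hΔ : a * d - b * c ≠ 0)
    (hq : Ideal.span {a, b, c, d} ^ 2 = Ideal.span {a * d - b * c})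
    (u v : B) (huv : ¬(u = 0 ∧ v = 0)) :
    Ideal.span {algebraMap A B a * u + algebraMap A B b * v,
        algebraMap A B c * u + algebraMap A B d * v} =
      Ideal.map (algebraMap A B) (Ideal.span {a, b, c, d}) * Ideal.span {u, v} := by
  have hmap : Ideal.map (algebraMap A B) (Ideal.span {a, b, c, d}) =
      Ideal.span {algebraMap A B a, algebraMap A B b, algebraMap A B c, algebraMap A B d} := by
    simp [Ideal.map_span, Set.image_insert_eq]
  rw [hmap]
  apply Ideal.span_pair_eq_mul_span_pair_of_sq_eq_span_det
  · simpa only [map_sub, map_mul] using (map_ne_zero_iff (algebraMap A B) hinj).mpr hΔ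
  · rw [← hmap, ← Ideal.map_pow, hq, Ideal.map_span, Set.image_singleton]
    simp only [map_sub, map_mul]
end

section
/- Let a, b, c, d ∈ A with Δ = ad − bc ≠ 0, and suppose the ideal 𝔮 = aA + bA + cA + dA satisfies 𝔮² = ΔA (equivalently, by Cremona's criterion, the matrix M = [[a,b],[c,d]] normalizes GL₂(A) in GL₂(K)). Then for all x, y ∈ A not both zero, the ideal (ax+by)A + (cx+dy)A equals 𝔮·(xA + yA); in particular, in the ideal class group Cl(A) one has [(ax+by)A + (cx+dy)A] = [𝔮]·[xA + yA]. -/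
/-- If `a, b, c, d ∈ A` with `Δ = ad - bc ≠ 0` and `(a,b,c,d)² = (Δ)` (Cremona's criterion for
the matrix `[[a,b],[c,d]]` to normalize `GL₂(A)`), then for `x, y ∈ A` not both zero,
`(ax+by, cx+dy) = (a,b,c,d)·(x,y)`; in particular `[(ax+by, cx+dy)] = [(a,b,c,d)]·[(x,y)]`
in the ideal class group `Cl(A)`. -/
theorem stmt_13 (A : Type*) [CommRing A] [IsDedekindDomain A] (hA : ¬ IsField A)
    (a b c d : A) (hΔ : a * d - b * c ≠ 0)
    (hq : Ideal.span {a, b, c, d} ^ 2 = Ideal.span {a * d - b * c})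
    (x y : A) (hxy : ¬(x = 0 ∧ y = 0)) :
    Ideal.span {a * x + b * y, c * x + d * y} =
      Ideal.span {a, b, c, d} * Ideal.span {x, y} ∧
    ∀ (h1 : Ideal.span {a * x + b * y, c * x + d * y} ∈ nonZeroDivisors (Ideal A))
      (h2 : Ideal.span {a, b, c, d} ∈ nonZeroDivisors (Ideal A))
      (h3 : Ideal.span {x, y} ∈ nonZeroDivisors (Ideal A)),
      ClassGroup.mk0 ⟨_, h1⟩ = ClassGroup.mk0 ⟨_, h2⟩ * ClassGroup.mk0 ⟨_, h3⟩ := by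
  have hq0 : Ideal.span {a, b, c, d} ≠ 0 := by
    intro h
    rw [h, zero_pow two_ne_zero] at hq
    exact hΔ (Ideal.span_singleton_eq_bot.mp hq.symm)
  have ha : a ∈ Ideal.span {a, b, c, d} := Ideal.subset_span (by simp)
  have hb : b ∈ Ideal.span {a, b, c, d} := Ideal.subset_span (by simp)
  have hc : c ∈ Ideal.span {a, b, c, d} := Ideal.subset_span (by simp)
  have hd : d ∈ Ideal.span {a, b, c, d} := Ideal.subset_span (by simp)
  have hx : x ∈ Ideal.span {x, y} := Ideal.subset_span (by simp)
  have hy : y ∈ Ideal.span {x, y} := Ideal.subset_span (by simp)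
  have hu : a * x + b * y ∈ Ideal.span {a * x + b * y, c * x + d * y} :=
    Ideal.subset_span (by simp)
  have hv : c * x + d * y ∈ Ideal.span {a * x + b * y, c * x + d * y} :=
    Ideal.subset_span (by simp)
  have key : Ideal.span {a * x + b * y, c * x + d * y} =
      Ideal.span {a, b, c, d} * Ideal.span {x, y} := by
    apply le_antisymm
    · rw [Ideal.span_le]
      rintro z (rfl | rfl)
      · exact add_mem (Ideal.mul_mem_mul ha hx) (Ideal.mul_mem_mul hb hy)
      · exact add_mem (Ideal.mul_mem_mul hc hx) (Ideal.mul_mem_mul hd hy)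
    · rw [← Ideal.dvd_iff_le, ← mul_dvd_mul_iff_left hq0, Ideal.dvd_iff_le, ← mul_assoc, ← pow_two,
        hq, Ideal.span_singleton_mul_le_iff]
      -- Cramer's rule: `Δ • (x, y)` is the adjugate matrix applied to `(ax + by, cx + dy)`.
      suffices h : Ideal.span {x, y} ≤ Submodule.comap (LinearMap.mulLeft A (a * d - b * c))
          (Ideal.span {a, b, c, d} * Ideal.span {a * x + b * y, c * x + d * y}) from
        fun z hz => h hz
      refine Submodule.span_le.mpr ?_
      rintro z (rfl | rfl)
      · have h := sub_mem (Ideal.mul_mem_mul hd hu) (Ideal.mul_mem_mul hb hv)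
        rw [SetLike.mem_coe, Submodule.mem_comap, LinearMap.mulLeft_apply]
        convert h using 1
        ring
      · have h := sub_mem (Ideal.mul_mem_mul ha hv) (Ideal.mul_mem_mul hc hu)
        rw [SetLike.mem_coe, Submodule.mem_comap, LinearMap.mulLeft_apply]
        convert h using 1
        ring
  refine ⟨key, fun h1 h2 h3 => ?_⟩
  rw [← map_mul]
  exact congrArg _ (Subtype.ext key)
end
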